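/- Let X ∈ 𝔹^{d×n}_{≠0}. If d ≥ n and ‖X‖₀ ≥ n² + 3n, then C_P(X) ≤ C_D(X). Symmetrically, if n ≥ d and ‖X‖₀ ≥ d² + 3d, then C_D(X) ≤ C_P(X). -/

import Mathlib

open scoped BigOperators

/-- Number of nonzero entries of row `i` of `X`. -/
noncomputable def nnzRow {d n : ℕ} (X : Matrix (Fin d) (Fin n) ℝ) (i : Fin d) : ℕ :=
  (Finset.univ.filter fun j => X i j ≠ 0).card

/-- Number of nonzero entries of column `j` of `X`. -/
noncomputable def nnzCol {d n : ℕ} (X : Matrix (Fin d) (Fin n) ℝ) (j : Fin n) : ℕ :=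
  (Finset.univ.filter fun i => X i j ≠ 0).card

/-- Total number of nonzero entries of `X`. -/
noncomputable def nnz {d n : ℕ} (X : Matrix (Fin d) (Fin n) ℝ) : ℕ :=
  ∑ i, nnzRow X i

/-- `X` has all its entries in `{−1, 0, 1}`. -/
def IsBinary {d n : ℕ} (X : Matrix (Fin d) (Fin n) ℝ) : Prop :=
  ∀ i j, X i j = -1 ∨ X i j = 0 ∨ X i j = 1

/-- `X` has no zero row and no zero column. -/
def NoZeroRowCol {d n : ℕ} (X : Matrix (Fin d) (Fin n) ℝ) : Prop :=
  (∀ i, ∃ j, X i j ≠ 0) ∧ (∀ j, ∃ i, X i j ≠ 0)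

/-- For binary matrices, `C_P(X) = ∑ᵢ ‖X₍i:₎‖₀²`. -/
noncomputable def CP {d n : ℕ} (X : Matrix (Fin d) (Fin n) ℝ) : ℕ :=
  ∑ i, nnzRow X i ^ 2

/-- For binary matrices, `C_D(X) = ∑ⱼ ‖X₍:j₎‖₀²`. -/
noncomputable def CD {d n : ℕ} (X : Matrix (Fin d) (Fin n) ℝ) : ℕ :=
  ∑ j, nnzCol X j ^ 2

/-- `ā_b = b⌊a/b⌋`: `a` rounded down to the closest multiple of `b`. -/
def rnd (a b : ℕ) : ℕ := b * (a / b)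

/-- `L(α, n) = (1/n)(ᾱ_n² + (α − ᾱ_n)(2ᾱ_n + n))`. -/
noncomputable def Lfun (α n : ℕ) : ℝ :=
  (1 / (n : ℝ)) * ((rnd α n : ℝ) ^ 2 +
    ((α - rnd α n : ℕ) : ℝ) * (2 * (rnd α n : ℝ) + (n : ℝ)))

/-- `U(α, d, n) = (d+1)·(α−n)̄_{d−1} + n − 1 + (α − n + 1 − (α−n)̄_{d−1})²`. -/
noncomputable def Ufun (α d n : ℕ) : ℝ :=
  ((d : ℝ) + 1) * (rnd (α - n) (d - 1) : ℝ) + (n : ℝ) - 1 +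
    ((α - n + 1 - rnd (α - n) (d - 1) : ℕ) : ℝ) ^ 2

theorem sum_sq_le_aux {d n : ℕ} (f : Fin d → ℕ) (g : Fin n → ℕ) (hf : ∀ i, f i ≤ n)
    (hfg : ∑ i, f i = ∑ j, g j) (h : n ^ 2 + 3 * n ≤ ∑ i, f i) :
    ∑ i, f i ^ 2 ≤ ∑ j, g j ^ 2 := by
  have h1 : ∑ i, f i ^ 2 ≤ n * ∑ i, f i := by
    rw [Finset.mul_sum]
    refine Finset.sum_le_sum fun i _ => ?_
    rw [sq]
    exact Nat.mul_le_mul_right _ (hf i)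
  have h2 : (∑ j, g j) ^ 2 ≤ n * ∑ j, g j ^ 2 := by
    have := sq_sum_le_card_mul_sum_sq (s := (Finset.univ : Finset (Fin n))) (f := g)
    simpa using this
  rw [← hfg] at h2
  rcases Nat.eq_zero_or_pos n with hn | hn
  · rw [hn, zero_mul] at h1
    omega
  · refine le_trans h1 (Nat.le_of_mul_le_mul_left ?_ hn)
    refine le_trans ?_ h2
    nlinarith [Nat.zero_le (∑ i, f i)]

theorem nnz_comm_aux {d n : ℕ} (X : Matrix (Fin d) (Fin n) ℝ) :
    ∑ i, nnzRow X i = ∑ j, nnzCol X j := by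
  simp only [nnzRow, nnzCol, Finset.card_filter]
  exact Finset.sum_comm

/-- For a binary matrix `X` with no zero row or column: if `d ≥ n` and
`‖X‖₀ ≥ n² + 3n` then `C_P(X) ≤ C_D(X)`; symmetrically, if `n ≥ d` and
`‖X‖₀ ≥ d² + 3d` then `C_D(X) ≤ C_P(X)`. -/
theorem dense_enough_binary
    (d n : ℕ) (X : Matrix (Fin d) (Fin n) ℝ)
    (hX : IsBinary X) (hnz : NoZeroRowCol X) :
    (n ≤ d → n ^ 2 + 3 * n ≤ nnz X → CP X ≤ CD X) ∧
    (d ≤ n → d ^ 2 + 3 * d ≤ nnz X → CD X ≤ CP X) := by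
  refine ⟨fun _ h => ?_, fun _ h => ?_⟩
  · refine sum_sq_le_aux _ _ (fun i => ?_) (nnz_comm_aux X) h
    exact (Finset.card_le_univ _).trans (by simp)
  · refine sum_sq_le_aux _ _ (fun j => ?_) (nnz_comm_aux X).symm ?_
    · exact (Finset.card_le_univ _).trans (by simp)
    · rw [← nnz_comm_aux X]
      exact h
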